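/- Let δ > 0, s > 3/2 and s−1 ≤ s' ≤ s+1, and let ω = (ω_k)_{k ≥ −1} ∈ AF(δ). There exists a constant C > 0, depending only on δ, s, s' and the cutoff pair (χ, φ) but not on ω, such that for all Schwartz vector fields u, B : ℝ³ → ℝ³ one has ∥u × B∥_{H^s(ω)} ≤ C ( ∥∇u∥_{H^{s'}} ∥B∥_{H^s(ω)} + ∥∇u∥_{H^{s'}(ω)} ∥B∥_{H^s} ), where × is the pointwise cross product on ℝ³. -/

import Mathlib

open MeasureTheory SchwartzMap Real
open scoped FourierTransform ENNReal NNReal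

noncomputable section

/-- `ℝ³` as a Euclidean space. -/
abbrev E3 : Type := EuclideanSpace ℝ (Fin 3)

/-- A Littlewood–Paley cutoff pair `(χ, φ)`: smooth functions with
`supp χ ⊆ {|ξ| ≤ 4/3}`, `supp φ ⊆ {3/4 ≤ |ξ| ≤ 8/3}` and
`χ(ξ) + Σ_{k ≥ 0} φ(2^{-k} ξ) = 1` for all `ξ`. -/
structure LPCutoff where
  χ : E3 → ℝ
  φ : E3 → ℝ
  smooth_χ : ContDiff ℝ (⊤ : ℕ∞) χ
  smooth_φ : ContDiff ℝ (⊤ : ℕ∞) φ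
  supp_χ : ∀ ξ : E3, 4 / 3 < ‖ξ‖ → χ ξ = 0
  supp_φ : ∀ ξ : E3, ‖ξ‖ < 3 / 4 ∨ 8 / 3 < ‖ξ‖ → φ ξ = 0
  partition : ∀ ξ : E3, χ ξ + ∑' k : ℕ, φ ((2 : ℝ) ^ (-(k : ℤ)) • ξ) = 1

/-- The Littlewood–Paley block `Δ_k f`, indexed by `n : ℕ` corresponding to `k = n - 1 ≥ -1`
(blocks with `k ≤ -2` vanish):
`Δ_{-1} f = 𝓕⁻¹(χ 𝓕f)` and `Δ_k f = 𝓕⁻¹(φ(2^{-k}·) 𝓕f)` for `k ≥ 0`. -/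
def LPblock (P : LPCutoff) (n : ℕ) (f : E3 → ℂ) : E3 → ℂ :=
  if n = 0 then 𝓕⁻ (fun ξ => (P.χ ξ : ℂ) * 𝓕 f ξ)
  else 𝓕⁻ (fun ξ => (P.φ ((2 : ℝ) ^ (-((n : ℤ) - 1)) • ξ) : ℂ) * 𝓕 f ξ)

/-- `LPlow P j f = Σ_{n < j} Δ^{(n)} f`, i.e. the low-frequency cutoff `S_{j-1} f`
in the paper's indexing (so `S_j f = LPlow P (j+1) f`). -/
def LPlow (P : LPCutoff) (j : ℕ) (f : E3 → ℂ) : E3 → ℂ :=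
  fun x => ∑ n ∈ Finset.range j, LPblock P n f x

/-- Bony's paraproduct `T_f g = Σ_l S_{l-1} f · Δ_l g` (the terms with `l ≤ 0` vanish). -/
def paraproduct (P : LPCutoff) (f g : E3 → ℂ) : E3 → ℂ :=
  fun x => ∑' l : ℕ, LPlow P (l + 1) f x * LPblock P (l + 2) g x

/-- Bony's remainder `R(f,g) = Σ_l Δ_l f · (Δ_{l-1} + Δ_l + Δ_{l+1}) g`
(the terms with `l ≤ -2` vanish). -/
def lpRemainder (P : LPCutoff) (f g : E3 → ℂ) : E3 → ℂ :=
  fun x => ∑' n : ℕ, LPblock P n f x *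
    ((if n = 0 then 0 else LPblock P (n - 1) g x) +
      LPblock P n g x + LPblock P (n + 1) g x)

/-- The weighted Besov norm `∥f∥_{B^s_{p,r}(ω)}`: the `ℓ^r` norm (over `k = n - 1 ≥ -1`)
of `(ω_k 2^{ks} ∥Δ_k f∥_{L^p})`. -/
def besovW (P : LPCutoff) (ω : ℕ → ℝ) (s : ℝ) (p r : ℝ≥0∞) (f : E3 → ℂ) : ℝ≥0∞ :=
  eLpNorm (fun n : ℕ =>
    ω n * (2 : ℝ) ^ (((n : ℝ) - 1) * s) * (eLpNorm (LPblock P n f) p volume).toReal)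
    r (Measure.count : Measure ℕ)

/-- The (unweighted) Besov norm `∥f∥_{B^s_{p,r}}`. -/
def besov (P : LPCutoff) (s : ℝ) (p r : ℝ≥0∞) (f : E3 → ℂ) : ℝ≥0∞ :=
  besovW P (fun _ => 1) s p r f

/-- The `j`-th partial derivative of a complex-valued function on `ℝ³`. -/
def pdC (j : Fin 3) (f : E3 → ℂ) : E3 → ℂ :=
  fun x => fderiv ℝ f x (EuclideanSpace.single j 1)

/-- The weighted Besov norm of a gradient, `∥∇g∥_{B^s_{p,r}(ω)}`: the `ℓ^r` norm over
`k = n - 1 ≥ -1` of `(ω_k 2^{ks} (Σ_j ∥Δ_k ∂_j g∥_{L^p}²)^{1/2})`. -/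
def gradBesovW (P : LPCutoff) (ω : ℕ → ℝ) (s : ℝ) (p r : ℝ≥0∞) (g : E3 → ℂ) : ℝ≥0∞ :=
  eLpNorm (fun n : ℕ =>
    ω n * (2 : ℝ) ^ (((n : ℝ) - 1) * s) *
      (∑ j : Fin 3, ((eLpNorm (LPblock P n (pdC j g)) p volume).toReal) ^ 2) ^ ((1 : ℝ) / 2))
    r (Measure.count : Measure ℕ)

/-- An acceptable frequency weight of parameter `δ`:
`1 ≤ ω_k ≤ ω_{k+1} ≤ 2^δ ω_k` for all `k ≥ -1`. -/
def AFweight (δ : ℝ) (ω : ℕ → ℝ) : Prop :=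
  ∀ k : ℕ, 1 ≤ ω k ∧ ω k ≤ ω (k + 1) ∧ ω (k + 1) ≤ (2 : ℝ) ^ δ * ω k

/-- The weighted Sobolev norm `∥f∥_{H^σ(ω)}` of a complex-valued function, defined via
Littlewood–Paley blocks: `∥f∥_{H^σ(ω)}² = Σ_{k ≥ -1} ω_k² 2^{2kσ} ∥Δ_k f∥_{L²}²`
(index shift `k = n - 1`). -/
def HLPw (P : LPCutoff) (ω : ℕ → ℝ) (σ : ℝ) (f : E3 → ℂ) : ℝ≥0∞ :=
  (∑' n : ℕ, ENNReal.ofReal (ω n ^ 2 * (2 : ℝ) ^ (2 * ((n : ℝ) - 1) * σ)) *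
      eLpNorm (LPblock P n f) 2 volume ^ 2) ^ ((1 : ℝ) / 2)

/-- The unweighted Sobolev norm `∥f∥_{H^σ}` via Littlewood–Paley blocks. -/
def HLP (P : LPCutoff) (σ : ℝ) (f : E3 → ℂ) : ℝ≥0∞ :=
  HLPw P (fun _ => 1) σ f

/-- The `j`-th partial derivative of a real-valued function on `ℝ³`. -/
def pdR (j : Fin 3) (f : E3 → ℝ) : E3 → ℝ :=
  fun x => fderiv ℝ f x (EuclideanSpace.single j 1)

/-- `∥u∥_{H^σ(ω)}² = Σ_i ∥u_i∥_{H^σ(ω)}²` for a vector field `u : ℝ³ → ℝ³`. -/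
def HLPwV (P : LPCutoff) (ω : ℕ → ℝ) (σ : ℝ) (u : Fin 3 → E3 → ℝ) : ℝ≥0∞ :=
  (∑ i : Fin 3, HLPw P ω σ (fun x => (u i x : ℂ)) ^ 2) ^ ((1 : ℝ) / 2)

/-- `∥u∥_{H^σ}²  = Σ_i ∥u_i∥_{H^σ}²`. -/
def HLPV (P : LPCutoff) (σ : ℝ) (u : Fin 3 → E3 → ℝ) : ℝ≥0∞ :=
  HLPwV P (fun _ => 1) σ u

/-- `∥∇u∥_{H^σ(ω)}² = Σ_{i,j} ∥∂_j u_i∥_{H^σ(ω)}²`. -/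
def gradHLPwV (P : LPCutoff) (ω : ℕ → ℝ) (σ : ℝ) (u : Fin 3 → E3 → ℝ) : ℝ≥0∞ :=
  (∑ i : Fin 3, ∑ j : Fin 3, HLPw P ω σ (fun x => (pdR j (u i) x : ℂ)) ^ 2) ^ ((1 : ℝ) / 2)

/-- `∥∇u∥_{H^σ}² = Σ_{i,j} ∥∂_j u_i∥_{H^σ}²`. -/
def gradHLPV (P : LPCutoff) (σ : ℝ) (u : Fin 3 → E3 → ℝ) : ℝ≥0∞ :=
  gradHLPwV P (fun _ => 1) σ u

/-- The pointwise cross product of two vector fields on `ℝ³`. -/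
def crossVF (u v : Fin 3 → E3 → ℝ) : Fin 3 → E3 → ℝ :=
  fun i x =>
    ![u 1 x * v 2 x - u 2 x * v 1 x,
      u 2 x * v 0 x - u 0 x * v 2 x,
      u 0 x * v 1 x - u 1 x * v 0 x] i

/-- A Schwartz vector field, viewed as a plain vector field. -/
def toVF (u : Fin 3 → SchwartzMap E3 ℝ) : Fin 3 → E3 → ℝ :=
  fun i => ⇑(u i)


section Lintegral

/-- Cauchy–Schwarz for lower Lebesgue integrals, in squared form. -/
lemma lintegral_mul_sq_le {α : Type*} [MeasurableSpace α] {μ : Measure α} {f g : α → ℝ≥0∞}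
    (hf : AEMeasurable f μ) (hg : AEMeasurable g μ) :
    (∫⁻ a, f a * g a ∂μ) ^ 2 ≤ (∫⁻ a, f a ^ 2 ∂μ) * ∫⁻ a, g a ^ 2 ∂μ := by
  have h := ENNReal.lintegral_mul_le_Lp_mul_Lq μ Real.HolderConjugate.two_two hf hg
  simp only [Pi.mul_apply, ENNReal.rpow_two] at h
  calc (∫⁻ a, f a * g a ∂μ) ^ 2
      ≤ ((∫⁻ a, f a ^ 2 ∂μ) ^ (1 / 2 : ℝ) * (∫⁻ a, g a ^ 2 ∂μ) ^ (1 / 2 : ℝ)) ^ 2 := by gcongr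
    _ = _ := by
      rw [mul_pow, ← ENNReal.rpow_two, ← ENNReal.rpow_two, ← ENNReal.rpow_mul, ← ENNReal.rpow_mul]
      norm_num

lemma ENNReal.add_sq_le (a b : ℝ≥0∞) : (a + b) ^ 2 ≤ 2 * (a ^ 2 + b ^ 2) := by
  have h := ENNReal.rpow_add_le_mul_rpow_add_rpow a b (p := 2) (by norm_num)
  norm_num at h
  exact_mod_cast h

variable {G : Type*} [AddCommGroup G] [MeasurableSpace G] [MeasurableAdd₂ G] [MeasurableNeg G]
  {μ : Measure G} [SFinite μ] [μ.IsAddLeftInvariant]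

/-- Young's inequality `L¹ * L² ⊆ L²` for nonnegative functions. -/
lemma lintegral_conv_sq_le {a b : G → ℝ≥0∞} (ha : Measurable a) (hb : Measurable b) :
    ∫⁻ x, (∫⁻ y, a y * b (x - y) ∂μ) ^ 2 ∂μ ≤ (∫⁻ y, a y ∂μ) ^ 2 * ∫⁻ x, b x ^ 2 ∂μ := by
  have hb' (x : G) : Measurable fun y => b (x - y) := by fun_prop
  have hroot (t : ℝ≥0∞) : (t ^ (1 / 2 : ℝ)) ^ 2 = t := by
    rw [← ENNReal.rpow_two, ← ENNReal.rpow_mul]; norm_num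
  calc ∫⁻ x, (∫⁻ y, a y * b (x - y) ∂μ) ^ 2 ∂μ
      ≤ ∫⁻ x, (∫⁻ y, a y ∂μ) * ∫⁻ y, a y * b (x - y) ^ 2 ∂μ ∂μ := by
        refine lintegral_mono fun x => ?_
        have h := lintegral_mul_sq_le (μ := μ) (f := fun y => a y ^ (1 / 2 : ℝ))
          (g := fun y => a y ^ (1 / 2 : ℝ) * b (x - y))
          (by fun_prop) ((ha.pow_const _).mul (hb' x)).aemeasurable
        simp only [mul_pow, hroot, ← mul_assoc] at h
        simpa only [← sq, hroot] using h
    _ = (∫⁻ y, a y ∂μ) * ∫⁻ y, a y * ∫⁻ x, b x ^ 2 ∂μ ∂μ := by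
        rw [lintegral_const_mul _ (by fun_prop), lintegral_lintegral_swap (by fun_prop)]
        congr 1
        refine lintegral_congr fun y => ?_
        rw [lintegral_const_mul _ (by fun_prop)]
        congr 1
        exact lintegral_sub_right_eq_self (fun x => b x ^ 2) y
    _ = _ := by
        rw [lintegral_mul_const _ ha]
        ring

/-- Young's inequality `L² * L¹ ⊆ L²` for nonnegative functions. -/
lemma lintegral_conv_sq_le' [μ.IsNegInvariant] {a b : G → ℝ≥0∞} (ha : Measurable a) (hb : Measurable b) :
    ∫⁻ x, (∫⁻ y, a y * b (x - y) ∂μ) ^ 2 ∂μ ≤ (∫⁻ x, a x ^ 2 ∂μ) * (∫⁻ y, b y ∂μ) ^ 2 := by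
  rw [mul_comm]
  refine le_trans (le_of_eq (lintegral_congr fun x => ?_)) (lintegral_conv_sq_le hb ha)
  rw [← lintegral_sub_left_eq_self _ x]
  simp [mul_comm]

end Lintegral

section FrequencyIndex

/-- The dyadic index of a frequency: `N = 0` if `|ξ| < 2` and `2 ^ N ≤ |ξ| < 2 ^ (N + 1)`
otherwise. -/
def freqIndex (ξ : E3) : ℕ := Nat.log 2 ⌊‖ξ‖⌋₊

lemma measurable_freqIndex : Measurable freqIndex :=
  (measurable_from_top (f := Nat.log 2)).comp (Nat.measurable_floor.comp measurable_norm)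

lemma two_pow_freqIndex_le {ξ : E3} (h : 1 ≤ ‖ξ‖) : (2 : ℝ) ^ freqIndex ξ ≤ ‖ξ‖ := by
  have h1 : ⌊‖ξ‖⌋₊ ≠ 0 := (Nat.floor_pos.2 h).ne'
  calc (2 : ℝ) ^ freqIndex ξ = ((2 ^ freqIndex ξ : ℕ) : ℝ) := by push_cast; rfl
    _ ≤ (⌊‖ξ‖⌋₊ : ℝ) := by exact_mod_cast Nat.pow_log_le_self 2 h1
    _ ≤ ‖ξ‖ := Nat.floor_le (norm_nonneg _)

lemma norm_lt_two_pow_freqIndex (ξ : E3) : ‖ξ‖ < 2 ^ (freqIndex ξ + 1) := by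
  have h := Nat.lt_pow_succ_log_self (b := 2) (by norm_num) ⌊‖ξ‖⌋₊
  rw [Nat.floor_lt (norm_nonneg _)] at h
  exact_mod_cast h

lemma freqIndex_eq_zero {ξ : E3} (h : ‖ξ‖ < 2) : freqIndex ξ = 0 := by
  rw [freqIndex, Nat.log_eq_zero_iff]
  exact Or.inl ((Nat.floor_lt (norm_nonneg _)).2 (by exact_mod_cast h))

lemma one_le_norm_of_freqIndex_ne_zero {ξ : E3} (h : freqIndex ξ ≠ 0) : 1 ≤ ‖ξ‖ := by
  by_contra! h1
  exact h (freqIndex_eq_zero (by linarith))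

lemma freqIndex_lt_of_norm_lt {ξ : E3} {n : ℕ} (hn : 0 < n) (h : ‖ξ‖ < 2 ^ n) :
    freqIndex ξ < n := by
  by_cases h0 : freqIndex ξ = 0
  · omega
  · have := (two_pow_freqIndex_le (one_le_norm_of_freqIndex_ne_zero h0)).trans_lt h
    exact (pow_lt_pow_iff_right₀ (by norm_num : (1 : ℝ) < 2)).1 this

lemma freqIndex_le_succ_of_norm_le {ξ η : E3} (h : ‖ξ‖ ≤ 2 * ‖η‖) :
    freqIndex ξ ≤ freqIndex η + 1 := by
  refine Nat.lt_succ_iff.1 (freqIndex_lt_of_norm_lt (by omega) (h.trans_lt ?_))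
  have := norm_lt_two_pow_freqIndex η
  rw [pow_succ]
  linarith

end FrequencyIndex

section Symbol

/-- The Fourier multiplier of the `n`-th Littlewood–Paley block. -/
def lpSymbol (P : LPCutoff) (n : ℕ) (ξ : E3) : ℝ :=
  if n = 0 then P.χ ξ else P.φ ((2 : ℝ) ^ (-((n : ℤ) - 1)) • ξ)

lemma LPblock_eq (P : LPCutoff) (n : ℕ) (f : E3 → ℂ) :
    LPblock P n f = 𝓕⁻ (fun ξ => (lpSymbol P n ξ : ℂ) * 𝓕 f ξ) := by
  by_cases h : n = 0 <;> simp [LPblock, lpSymbol, h]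

lemma lpSymbol_succ (P : LPCutoff) (n : ℕ) (ξ : E3) :
    lpSymbol P (n + 1) ξ = P.φ ((2 : ℝ) ^ (-(n : ℤ)) • ξ) := by
  simp [lpSymbol]

lemma contDiff_lpSymbol (P : LPCutoff) (n : ℕ) : ContDiff ℝ (⊤ : ℕ∞) (lpSymbol P n) := by
  cases n with
  | zero => exact P.smooth_χ
  | succ n =>
    have : lpSymbol P (n + 1) = fun ξ => P.φ ((2 : ℝ) ^ (-(n : ℤ)) • ξ) :=
      funext (lpSymbol_succ P n)
    rw [this]
    exact P.smooth_φ.comp (contDiff_const_smul _)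

/-- Support of the symbols in terms of the dyadic index. -/
lemma freqIndex_mem_of_lpSymbol_ne_zero {P : LPCutoff} {n : ℕ} {ξ : E3}
    (h : lpSymbol P n ξ ≠ 0) : freqIndex ξ ≤ n ∧ n ≤ freqIndex ξ + 2 := by
  cases n with
  | zero =>
    have h1 : ‖ξ‖ ≤ 4 / 3 := by
      by_contra! hc
      exact h (P.supp_χ ξ hc)
    simp [freqIndex_eq_zero (show ‖ξ‖ < 2 by linarith)]
  | succ n =>
    rw [lpSymbol_succ] at h
    have hnorm : ‖(2 : ℝ) ^ (-(n : ℤ)) • ξ‖ = ‖ξ‖ / 2 ^ n := by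
      rw [norm_smul, zpow_neg, zpow_natCast, norm_inv, norm_pow, Real.norm_ofNat]
      field_simp
    have hp : (0 : ℝ) < 2 ^ n := by positivity
    have h1 : 3 / 4 * 2 ^ n ≤ ‖ξ‖ := by
      by_contra! hc
      exact h (P.supp_φ _ (Or.inl (by rw [hnorm, div_lt_iff₀ hp]; exact hc)))
    have h2 : ‖ξ‖ ≤ 8 / 3 * 2 ^ n := by
      by_contra! hc
      exact h (P.supp_φ _ (Or.inr (by rw [hnorm, lt_div_iff₀ hp]; exact hc)))
    constructor
    · refine Nat.lt_succ_iff.1 (freqIndex_lt_of_norm_lt (by omega) (h2.trans_lt ?_))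
      rw [pow_succ, pow_succ]
      linarith
    · have h3 := norm_lt_two_pow_freqIndex ξ
      have h4 : (2 : ℝ) ^ n < 2 ^ (freqIndex ξ + 2) := by
        rw [pow_succ] at h3 ⊢
        rw [pow_succ]
        linarith [show (0 : ℝ) < 2 ^ freqIndex ξ by positivity]
      have := (pow_lt_pow_iff_right₀ (by norm_num : (1 : ℝ) < 2)).1 h4
      omega

lemma sum_lpSymbol (P : LPCutoff) (ξ : E3) :
    ∑ n ∈ Finset.Icc (freqIndex ξ) (freqIndex ξ + 2), lpSymbol P n ξ = 1 := by
  have hsupp : ∀ n ∉ Finset.Icc (freqIndex ξ) (freqIndex ξ + 2), lpSymbol P n ξ = 0 := by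
    intro n hn
    by_contra h
    exact hn (Finset.mem_Icc.2 (freqIndex_mem_of_lpSymbol_ne_zero h))
  have h := (summable_of_ne_finset_zero (L := .unconditional ℕ) hsupp).tsum_eq_zero_add
  rw [tsum_eq_sum hsupp] at h
  simp only [lpSymbol_succ] at h
  exact h.trans (P.partition ξ)

lemma hasCompactSupport_lpSymbol (P : LPCutoff) (n : ℕ) : HasCompactSupport (lpSymbol P n) := by
  refine HasCompactSupport.of_support_subset_isCompact
    (isCompact_closedBall (0 : E3) (2 ^ (n + 1))) fun ξ hξ => ?_
  rw [mem_closedBall_zero_iff]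
  refine (norm_lt_two_pow_freqIndex ξ).le.trans ?_
  gcongr
  · norm_num
  · exact (freqIndex_mem_of_lpSymbol_ne_zero hξ).1

lemma exists_abs_lpSymbol_le (P : LPCutoff) : ∃ M : ℝ, ∀ n ξ, |lpSymbol P n ξ| ≤ M := by
  have hcont (n : ℕ) := (contDiff_lpSymbol P n).continuous
  obtain ⟨M₀, h₀⟩ := (hcont 0).bounded_above_of_compact_support (hasCompactSupport_lpSymbol P 0)
  obtain ⟨M₁, h₁⟩ := (hcont 1).bounded_above_of_compact_support (hasCompactSupport_lpSymbol P 1)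
  refine ⟨max M₀ M₁, fun n ξ => ?_⟩
  cases n with
  | zero => exact (h₀ ξ).trans (le_max_left _ _)
  | succ n =>
    have h := h₁ ((2 : ℝ) ^ (-(n : ℤ)) • ξ)
    have h2 := lpSymbol_succ P 0 ((2 : ℝ) ^ (-(n : ℤ)) • ξ)
    simp only [zero_add, Nat.cast_zero, neg_zero, zpow_zero, one_smul] at h2
    rw [h2] at h
    rw [lpSymbol_succ]
    exact h.trans (le_max_right _ _)

end Symbol

section Fourier

lemma eLpNorm_two_sq {α E : Type*} [MeasurableSpace α] [NormedAddCommGroup E] {μ : Measure α}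
    (f : α → E) : eLpNorm f 2 μ ^ 2 = ∫⁻ x, ‖f x‖ₑ ^ 2 ∂μ := by
  rw [eLpNorm_eq_lintegral_rpow_enorm_toReal (by norm_num) (by norm_num), ← ENNReal.rpow_two,
    ← ENNReal.rpow_mul]
  norm_num

/-- Plancherel's identity, as an identity of lower Lebesgue integrals. -/
lemma eLpNorm_fourierInv_sq (h : 𝓢(E3, ℂ)) :
    eLpNorm (𝓕⁻ (h : E3 → ℂ)) 2 volume ^ 2 = ∫⁻ ξ, ‖h ξ‖ₑ ^ 2 := by
  have key : ‖h.toLp 2‖ = ‖(𝓕⁻ h).toLp 2‖ := by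
    simpa only [FourierTransform.fourier_fourierInv_eq] using norm_fourier_toL2_eq (𝓕⁻ h)
  rw [norm_toLp, norm_toLp] at key
  generalize hg : (𝓕⁻ h : 𝓢(E3, ℂ)) = g at key
  have e := (ENNReal.toReal_eq_toReal_iff' (h.memLp 2 volume).eLpNorm_ne_top
    (g.memLp 2 volume).eLpNorm_ne_top).1 key
  rw [← fourierInv_coe, hg, ← e, eLpNorm_two_sq]

lemma fourierInv_mul_eq_integral (f g : 𝓢(E3, ℂ)) (x : E3) :
    𝓕⁻ (fun y => f y * g y) x = ∫ t, 𝓕⁻ f t * 𝓕⁻ g (x - t) := by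
  have h := convolution_apply (ContinuousLinearMap.mul ℂ ℂ) (𝓕⁻ f) (𝓕⁻ g) x
  have h2 : SchwartzMap.convolution (ContinuousLinearMap.mul ℂ ℂ) (𝓕⁻ f) (𝓕⁻ g) =
      𝓕⁻ (pairing (ContinuousLinearMap.mul ℂ ℂ) f g) := by
    simp [SchwartzMap.convolution]
  rw [h2, fourierInv_coe, pairing_apply] at h
  simpa [MeasureTheory.convolution] using h

/-- The Fourier transform of a product is dominated by the convolution of the Fourier
transforms. -/
lemma enorm_fourier_mul_le (f g : 𝓢(E3, ℂ)) (ξ : E3) :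
    ‖𝓕 (fun x => f x * g x) ξ‖ₑ ≤
      ∫⁻ η, ‖𝓕 (f : E3 → ℂ) η‖ₑ * ‖𝓕 (g : E3 → ℂ) (ξ - η)‖ₑ := by
  have hinv (h : E3 → ℂ) (y : E3) : 𝓕⁻ h y = 𝓕 h (-y) := Real.fourierInv_eq_fourier_neg h y
  have h := fourierInv_mul_eq_integral f g (-ξ)
  simp only [fourierInv_coe, hinv, neg_neg] at h
  rw [h]
  refine (enorm_integral_le_lintegral_enorm _).trans (le_of_eq ?_)
  rw [← lintegral_neg_eq_self]
  refine lintegral_congr fun η => ?_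
  rw [enorm_mul, neg_neg, show -(-ξ - -η) = ξ - η by abel]

/-- A real-valued Schwartz function, regarded as complex-valued. -/
def complexify (f : 𝓢(E3, ℝ)) : 𝓢(E3, ℂ) := f.postcompCLM Complex.ofRealCLM

lemma complexify_apply (f : 𝓢(E3, ℝ)) (x : E3) : complexify f x = (f x : ℂ) := rfl

lemma pdR_eq (j : Fin 3) (f : 𝓢(E3, ℝ)) :
    (fun x => (pdR j f x : ℂ)) =
      LineDeriv.lineDerivOp (EuclideanSpace.single j (1 : ℝ)) (complexify f) := by
  ext x
  rw [lineDerivOp_apply_eq_fderiv]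
  have h : HasFDerivAt (complexify f) (Complex.ofRealCLM ∘L fderiv ℝ f x) x :=
    Complex.ofRealCLM.hasFDerivAt.comp x f.differentiableAt.hasFDerivAt
  rw [h.fderiv]
  rfl

lemma enorm_fourier_lineDerivOp (f : 𝓢(E3, ℂ)) (j : Fin 3) (ξ : E3) :
    ‖𝓕 (LineDeriv.lineDerivOp (EuclideanSpace.single j (1 : ℝ)) f : E3 → ℂ) ξ‖ₑ =
      ENNReal.ofReal (2 * π * |ξ j|) * ‖𝓕 (f : E3 → ℂ) ξ‖ₑ := by
  have h := fourier_lineDerivOp_eq f (EuclideanSpace.single j (1 : ℝ))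
  have ht : (inner ℝ · (EuclideanSpace.single j (1 : ℝ)) : E3 → ℝ).HasTemperateGrowth := by
    fun_prop
  rw [← fourier_coe, h, smul_apply, smulLeftCLM_apply_apply ht, ← fourier_coe, enorm_smul,
    enorm_smul, ← mul_assoc, ← ofReal_norm, ← ofReal_norm,
    ← ENNReal.ofReal_mul (norm_nonneg _)]
  congr 2
  simp [EuclideanSpace.inner_single_right, abs_of_pos pi_pos]

end Fourier

section Weight

variable {δ : ℝ} {ω : ℕ → ℝ}

lemma AFweight.one_le (h : AFweight δ ω) (n : ℕ) : 1 ≤ ω n := (h n).1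

lemma AFweight.pos (h : AFweight δ ω) (n : ℕ) : 0 < ω n := one_pos.trans_le (h.one_le n)

lemma AFweight.monotone (h : AFweight δ ω) : Monotone ω := monotone_nat_of_le_succ fun n => (h n).2.1

lemma AFweight.add_le (h : AFweight δ ω) (n m : ℕ) :
    ω (n + m) ≤ ((2 : ℝ) ^ δ) ^ m * ω n := by
  induction m with
  | zero => simp
  | succ m ih =>
    calc ω (n + m + 1) ≤ 2 ^ δ * ω (n + m) := (h _).2.2
      _ ≤ 2 ^ δ * (((2 : ℝ) ^ δ) ^ m * ω n) := by gcongr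
      _ = _ := by ring

lemma afweight_one (hδ : 0 < δ) : AFweight δ fun _ => 1 := fun _ =>
  ⟨le_rfl, le_rfl, by simpa using Real.one_le_rpow one_le_two hδ.le⟩

/-- The frequency weight `ω_N 2 ^ (N σ)`, where `N` is the dyadic index of the frequency. -/
def freqWeight (ω : ℕ → ℝ) (σ : ℝ) (ξ : E3) : ℝ≥0∞ :=
  ENNReal.ofReal (ω (freqIndex ξ) * (2 : ℝ) ^ ((freqIndex ξ : ℝ) * σ))

lemma measurable_freqWeight (ω : ℕ → ℝ) (σ : ℝ) : Measurable (freqWeight ω σ) :=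
  (measurable_from_top
    (f := fun n : ℕ => ENNReal.ofReal (ω n * (2 : ℝ) ^ ((n : ℝ) * σ)))).comp measurable_freqIndex

lemma freqWeight_mono (h : AFweight δ ω) {σ τ : ℝ} (hστ : σ ≤ τ) (ξ : E3) :
    freqWeight ω σ ξ ≤ freqWeight ω τ ξ := by
  have := h.pos (freqIndex ξ)
  unfold freqWeight
  gcongr
  norm_num

lemma freqWeight_le_of_freqIndex_le (h : AFweight δ ω) {σ : ℝ} (hσ : 0 ≤ σ)
    {ξ η : E3} (hN : freqIndex ξ ≤ freqIndex η + 1) :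
    freqWeight ω σ ξ ≤ ENNReal.ofReal (2 ^ (δ + σ)) * freqWeight ω σ η := by
  rw [freqWeight, freqWeight, ← ENNReal.ofReal_mul (by positivity)]
  refine ENNReal.ofReal_le_ofReal ?_
  have h0 := h.pos (freqIndex η)
  have hω : ω (freqIndex ξ) ≤ 2 ^ δ * ω (freqIndex η) := by
    simpa using (h.monotone hN).trans (h.add_le _ 1)
  have hN' : (freqIndex ξ : ℝ) ≤ freqIndex η + 1 := by exact_mod_cast hN
  calc ω (freqIndex ξ) * (2 : ℝ) ^ ((freqIndex ξ : ℝ) * σ)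
      ≤ (2 ^ δ * ω (freqIndex η)) * (2 : ℝ) ^ (((freqIndex η : ℝ) + 1) * σ) := by
        gcongr
        norm_num
    _ = _ := by
        rw [add_mul, one_mul, Real.rpow_add two_pos, Real.rpow_add two_pos]
        ring

/-- High frequencies of `η` gain one power of `|η|`. -/
lemma freqWeight_le_enorm_mul (h : AFweight δ ω) (σ : ℝ) {η : E3} (hη : 1 ≤ ‖η‖) :
    freqWeight ω σ η ≤ ‖η‖ₑ * freqWeight ω (σ - 1) η := by
  have h0 := h.pos (freqIndex η)
  rw [freqWeight, freqWeight, ← ofReal_norm, ← ENNReal.ofReal_mul (norm_nonneg _)]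
  refine ENNReal.ofReal_le_ofReal ?_
  have hsplit : (2 : ℝ) ^ ((freqIndex η : ℝ) * σ) =
      2 ^ freqIndex η * (2 : ℝ) ^ ((freqIndex η : ℝ) * (σ - 1)) := by
    rw [← Real.rpow_natCast, ← Real.rpow_add two_pos]
    ring_nf
  rw [hsplit]
  have := two_pow_freqIndex_le hη
  calc ω (freqIndex η) * (2 ^ freqIndex η * (2 : ℝ) ^ ((freqIndex η : ℝ) * (σ - 1)))
      ≤ ω (freqIndex η) * (‖η‖ * (2 : ℝ) ^ ((freqIndex η : ℝ) * (σ - 1))) := by gcongr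
    _ = _ := by ring

/-- Quasi-subadditivity of the weight, where low frequencies of `η` never carry the weight. -/
lemma freqWeight_le_add (h : AFweight δ ω) {σ : ℝ} (hσ : 0 ≤ σ) (ξ η : E3) :
    freqWeight ω σ ξ ≤ ENNReal.ofReal (2 ^ (δ + σ)) *
      (freqWeight ω σ (ξ - η) + ‖η‖ₑ * freqWeight ω (σ - 1) η) := by
  by_cases h1 : freqIndex ξ ≤ freqIndex (ξ - η) + 1
  · refine (freqWeight_le_of_freqIndex_le h hσ h1).trans ?_
    gcongr
    exact le_self_add
  · have h2 : ‖ξ‖ ≤ 2 * ‖η‖ := by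
      by_contra! hc
      refine h1 (freqIndex_le_succ_of_norm_le ?_)
      have := norm_sub_norm_le ξ η
      linarith
    have h3 := freqIndex_le_succ_of_norm_le h2
    refine (freqWeight_le_of_freqIndex_le h hσ h3).trans ?_
    gcongr
    refine (freqWeight_le_enorm_mul h σ (one_le_norm_of_freqIndex_ne_zero ?_)).trans le_add_self
    omega

/-- The Fourier multiplier of the square of the Littlewood–Paley norm. -/
def lpSquareWeight (P : LPCutoff) (ω : ℕ → ℝ) (σ : ℝ) (ξ : E3) : ℝ≥0∞ :=
  ∑' n : ℕ, ENNReal.ofReal (ω n ^ 2 * (2 : ℝ) ^ (2 * ((n : ℝ) - 1) * σ)) *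
    ENNReal.ofReal (lpSymbol P n ξ ^ 2)

lemma measurable_lpSquareWeight (P : LPCutoff) (ω : ℕ → ℝ) (σ : ℝ) :
    Measurable (lpSquareWeight P ω σ) := by
  refine Measurable.tsum fun n => ?_
  have := (contDiff_lpSymbol P n).continuous.measurable
  fun_prop

lemma lpSquareWeight_eq_sum (P : LPCutoff) (ω : ℕ → ℝ) (σ : ℝ) (ξ : E3) :
    lpSquareWeight P ω σ ξ =
      ENNReal.ofReal (∑ n ∈ Finset.Icc (freqIndex ξ) (freqIndex ξ + 2),
        (ω n * (2 : ℝ) ^ (((n : ℝ) - 1) * σ)) ^ 2 * lpSymbol P n ξ ^ 2) := by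
  rw [ENNReal.ofReal_sum_of_nonneg fun _ _ => by positivity, lpSquareWeight,
    tsum_eq_sum (s := Finset.Icc (freqIndex ξ) (freqIndex ξ + 2))]
  · refine Finset.sum_congr rfl fun n _ => ?_
    rw [← ENNReal.ofReal_mul (by positivity), mul_pow, ← Real.rpow_natCast (2 ^ _),
      ← Real.rpow_mul two_pos.le]
    congr 4
    push_cast
    ring
  · intro n hn
    have : lpSymbol P n ξ = 0 := by
      by_contra hc
      exact hn (Finset.mem_Icc.2 (freqIndex_mem_of_lpSymbol_ne_zero hc))
    simp [this]

/-- The Littlewood–Paley square weight is comparable to the square of the frequency weight. -/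
lemma exists_lpSquareWeight_equiv (P : LPCutoff) (hδ : 0 < δ) {σ : ℝ} (hσ : 0 ≤ σ) :
    ∃ K : ℝ≥0, ∀ ω : ℕ → ℝ, AFweight δ ω → ∀ ξ : E3,
      lpSquareWeight P ω σ ξ ≤ K * freqWeight ω σ ξ ^ 2 ∧
        freqWeight ω σ ξ ^ 2 ≤ K * lpSquareWeight P ω σ ξ := by
  obtain ⟨M, hM⟩ := exists_abs_lpSymbol_le P
  set A : ℝ := 3 * ((((2 : ℝ) ^ δ) ^ 2 * 2 ^ σ) ^ 2 * M ^ 2)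
  set A' : ℝ := 3 * ((2 : ℝ) ^ σ) ^ 2
  refine ⟨(A + A').toNNReal, fun ω h ξ => ?_⟩
  set N := freqIndex ξ with hN
  set w : ℝ := ω N * (2 : ℝ) ^ ((N : ℝ) * σ)
  have hω := h.pos N
  have hW : freqWeight ω σ ξ ^ 2 = ENNReal.ofReal (w ^ 2) :=
    (ENNReal.ofReal_pow (by positivity) 2).symm
  have hA : 0 ≤ A := by positivity
  have hA' : 0 ≤ A' := by positivity
  have h2δ : 1 ≤ (2 : ℝ) ^ δ := Real.one_le_rpow one_le_two hδ.le
  rw [lpSquareWeight_eq_sum, hW, ← ENNReal.ofReal.eq_1, ← ENNReal.ofReal_mul (by positivity),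
    ← ENNReal.ofReal_mul (by positivity)]
  constructor <;> refine ENNReal.ofReal_le_ofReal ?_
  · calc _ ≤ ∑ n ∈ Finset.Icc N (N + 2), ((((2 : ℝ) ^ δ) ^ 2 * 2 ^ σ) * w) ^ 2 * M ^ 2 := by
          refine Finset.sum_le_sum fun n hn => ?_
          obtain ⟨h1, h2⟩ := Finset.mem_Icc.1 hn
          have hn' : (n : ℝ) ≤ N + 2 := by exact_mod_cast h2
          have hωn := h.pos n
          have hωn' : ω n ≤ ((2 : ℝ) ^ δ) ^ 2 * ω N := (h.monotone h2).trans (h.add_le N 2)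
          have hpow : (2 : ℝ) ^ (((n : ℝ) - 1) * σ) ≤ 2 ^ σ * 2 ^ ((N : ℝ) * σ) := by
            rw [← Real.rpow_add two_pos]
            refine Real.rpow_le_rpow_of_exponent_le one_le_two ?_
            nlinarith
          gcongr ?_ ^ 2 * ?_
          · calc _ ≤ (((2 : ℝ) ^ δ) ^ 2 * ω N) * (2 ^ σ * 2 ^ ((N : ℝ) * σ)) := by gcongr
              _ = _ := by ring
          · exact sq_le_sq' (by linarith [(abs_le.1 (hM n ξ)).1]) (abs_le.1 (hM n ξ)).2
      _ = A * w ^ 2 := by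
          rw [Finset.sum_const, Nat.card_Icc, show N + 2 + 1 - N = 3 by omega]
          simp only [A, nsmul_eq_mul]
          push_cast
          ring
      _ ≤ (A + A') * w ^ 2 := by gcongr; linarith
  · have hterm : ∀ n ∈ Finset.Icc N (N + 2),
        w ^ 2 * lpSymbol P n ξ ^ 2 ≤ ((2 : ℝ) ^ σ) ^ 2 *
          ((ω n * (2 : ℝ) ^ (((n : ℝ) - 1) * σ)) ^ 2 * lpSymbol P n ξ ^ 2) := by
      intro n hn
      obtain ⟨h1, h2⟩ := Finset.mem_Icc.1 hn
      have hn' : (N : ℝ) ≤ n := by exact_mod_cast h1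
      have hωn := h.monotone h1
      have hpow : (2 : ℝ) ^ ((N : ℝ) * σ) ≤ 2 ^ σ * (2 : ℝ) ^ (((n : ℝ) - 1) * σ) := by
        rw [← Real.rpow_add two_pos]
        refine Real.rpow_le_rpow_of_exponent_le one_le_two ?_
        nlinarith
      have hn0 := h.pos n
      rw [← mul_assoc (((2 : ℝ) ^ σ) ^ 2), ← mul_pow ((2 : ℝ) ^ σ)]
      refine mul_le_mul_of_nonneg_right (pow_le_pow_left₀ (by positivity) ?_ 2) (sq_nonneg _)
      calc w = ω N * (2 : ℝ) ^ ((N : ℝ) * σ) := rfl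
        _ ≤ ω n * (2 ^ σ * (2 : ℝ) ^ (((n : ℝ) - 1) * σ)) := by gcongr
        _ = _ := by ring
    have hone : 1 ≤ 3 * ∑ n ∈ Finset.Icc N (N + 2), lpSymbol P n ξ ^ 2 := by
      have := sq_sum_le_card_mul_sum_sq (s := Finset.Icc N (N + 2)) (f := fun n => lpSymbol P n ξ)
      rw [sum_lpSymbol, Nat.card_Icc, show N + 2 + 1 - N = 3 by omega] at this
      simpa using this
    calc w ^ 2 ≤ w ^ 2 * (3 * ∑ n ∈ Finset.Icc N (N + 2), lpSymbol P n ξ ^ 2) :=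
          le_mul_of_one_le_right (by positivity) hone
      _ = 3 * ∑ n ∈ Finset.Icc N (N + 2), w ^ 2 * lpSymbol P n ξ ^ 2 := by
          rw [← Finset.mul_sum]; ring
      _ ≤ 3 * ∑ n ∈ Finset.Icc N (N + 2), ((2 : ℝ) ^ σ) ^ 2 *
          ((ω n * (2 : ℝ) ^ (((n : ℝ) - 1) * σ)) ^ 2 * lpSymbol P n ξ ^ 2) := by
          exact mul_le_mul_of_nonneg_left (Finset.sum_le_sum hterm) (by norm_num)
      _ = A' * ∑ n ∈ Finset.Icc N (N + 2),
          ((ω n * (2 : ℝ) ^ (((n : ℝ) - 1) * σ)) ^ 2 * lpSymbol P n ξ ^ 2) := by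
          rw [← Finset.mul_sum]; ring
      _ ≤ _ := by
          gcongr
          linarith

end Weight

section Integrals

lemma lintegral_sq_le_of_weight {α : Type*} [MeasurableSpace α] {μ : Measure α} {V g : α → ℝ≥0∞}
    (hV : Measurable V) (hg : Measurable g) (h0 : ∀ᵐ x ∂μ, V x ≠ 0) (htop : ∀ x, V x ≠ ⊤) :
    (∫⁻ x, g x ∂μ) ^ 2 ≤ (∫⁻ x, (V x ^ 2)⁻¹ ∂μ) * ∫⁻ x, V x ^ 2 * g x ^ 2 ∂μ := by
  have h := lintegral_mul_sq_le (μ := μ) (f := fun x => (V x)⁻¹) (g := fun x => V x * g x)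
    (by fun_prop) (by fun_prop)
  have h1 : ∫⁻ x, (V x)⁻¹ * (V x * g x) ∂μ = ∫⁻ x, g x ∂μ := by
    refine lintegral_congr_ae ?_
    filter_upwards [h0] with x hx
    rw [← mul_assoc, ENNReal.inv_mul_cancel hx (htop x), one_mul]
  simpa only [h1, mul_pow, ← ENNReal.inv_pow] using h

lemma freqWeight_one_ne_zero (σ : ℝ) (ξ : E3) : freqWeight (fun _ => 1) σ ξ ≠ 0 := by
  simp only [freqWeight, one_mul]
  exact (ENNReal.ofReal_pos.2 (by positivity)).ne'

lemma freqWeight_ne_top (ω : ℕ → ℝ) (σ : ℝ) (ξ : E3) : freqWeight ω σ ξ ≠ ⊤ :=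
  ENNReal.ofReal_ne_top

lemma lintegral_freqWeight_inv_lt_top {s : ℝ} (hs : 3 / 2 < s) :
    ∫⁻ ξ : E3, (freqWeight (fun _ => 1) s ξ ^ 2)⁻¹ < ⊤ := by
  have hint : Integrable (fun ξ : E3 => (3 : ℝ) ^ (2 * s) * (1 + ‖ξ‖) ^ (-(2 * s))) := by
    refine (integrable_one_add_norm ?_).const_mul _
    simp only [finrank_euclideanSpace, Fintype.card_fin]
    push_cast
    linarith
  refine lt_of_le_of_lt (lintegral_mono fun ξ => ?_) hint.lintegral_lt_top
  have h1 : 1 + ‖ξ‖ ≤ 3 * 2 ^ freqIndex ξ := by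
    have h2 := norm_lt_two_pow_freqIndex ξ
    have h3 : (1 : ℝ) ≤ 2 ^ freqIndex ξ := one_le_pow₀ one_le_two
    rw [pow_succ] at h2
    linarith
  have h2 : (2 : ℝ) ^ ((freqIndex ξ : ℝ) * s) = ((2 : ℝ) ^ freqIndex ξ) ^ s := by
    rw [Real.rpow_mul two_pos.le, Real.rpow_natCast]
  rw [freqWeight, one_mul, ← ENNReal.ofReal_pow (by positivity),
    ← ENNReal.ofReal_inv_of_pos (by positivity), h2]
  refine ENNReal.ofReal_le_ofReal ?_
  rw [← Real.rpow_natCast, ← Real.rpow_mul (by positivity), Real.rpow_neg (by positivity),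
    ← div_eq_mul_inv, inv_le_comm₀ (by positivity) (by positivity), inv_div,
    ← Real.div_rpow (by positivity) (by norm_num), Nat.cast_ofNat, mul_comm s]
  exact Real.rpow_le_rpow (by positivity) (by linarith) (by linarith)

lemma setLIntegral_norm_inv_sq_lt_top :
    ∫⁻ ξ : E3 in Metric.ball 0 1, (‖ξ‖ₑ ^ 2)⁻¹ < ⊤ := by
  set F : ℝ → ℝ := fun y => (Set.Iio (1 : ℝ)).indicator (fun y => (y ^ 2)⁻¹) y with hF
  have hint : Integrable (fun ξ : E3 => F ‖ξ‖) := by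
    rw [integrable_fun_norm_addHaar]
    simp only [finrank_euclideanSpace, Fintype.card_fin]
    have h : IntegrableOn (fun y : ℝ => (Set.Iio (1 : ℝ)).indicator (fun _ => (1 : ℝ)) y)
        (Set.Ioi 0) := by
      rw [IntegrableOn, integrable_indicator_iff measurableSet_Iio, IntegrableOn,
        Measure.restrict_restrict measurableSet_Iio, Set.Iio_inter_Ioi]
      exact integrableOn_const (by simp)
    refine h.congr_fun (fun y hy => ?_) measurableSet_Ioi
    have hy' : y ≠ 0 := (Set.mem_Ioi.1 hy).ne'
    simp only [hF, Set.indicator, smul_eq_mul]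
    split_ifs
    · field_simp
    · simp
  rw [← lintegral_indicator measurableSet_ball]
  refine lt_of_le_of_lt (lintegral_mono_ae ?_) hint.lintegral_lt_top
  filter_upwards [Measure.ae_ne volume (0 : E3)] with ξ hξ
  by_cases h : ξ ∈ Metric.ball (0 : E3) 1
  · have h1 : ‖ξ‖ < 1 := by simpa using h
    have hpos : 0 < ‖ξ‖ := norm_pos_iff.2 hξ
    rw [Set.indicator_of_mem h, hF]
    simp only [Set.indicator, Set.mem_Iio, h1, if_true]
    rw [ENNReal.ofReal_inv_of_pos (by positivity), ENNReal.ofReal_pow (norm_nonneg _), ofReal_norm]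
  · simp [Set.indicator_of_notMem h]

lemma lintegral_gradWeight_inv_lt_top {s : ℝ} (hs : 3 / 2 < s) :
    ∫⁻ ξ : E3, ((‖ξ‖ₑ * freqWeight (fun _ => 1) (s - 1) ξ) ^ 2)⁻¹ < ⊤ := by
  have hle : ∀ ξ : E3, ((‖ξ‖ₑ * freqWeight (fun _ => 1) (s - 1) ξ) ^ 2)⁻¹ ≤
      (freqWeight (fun _ => 1) s ξ ^ 2)⁻¹ +
        (Metric.ball (0 : E3) 1).indicator (fun ξ => (‖ξ‖ₑ ^ 2)⁻¹) ξ := by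
    intro ξ
    by_cases h : ξ ∈ Metric.ball (0 : E3) 1
    · have h1 : ‖ξ‖ < 1 := by simpa using h
      rw [Set.indicator_of_mem h, freqWeight, freqIndex_eq_zero (by linarith)]
      simp
    · have h1 : 1 ≤ ‖ξ‖ := by simpa using h
      refine le_trans ?_ le_self_add
      gcongr
      exact freqWeight_le_enorm_mul (afweight_one one_pos) s h1
  refine lt_of_le_of_lt (lintegral_mono hle) ?_
  have hm := measurable_freqWeight (fun _ => 1) s
  rw [lintegral_add_left (by fun_prop), lintegral_indicator measurableSet_ball]
  exact ENNReal.add_lt_top.2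
    ⟨lintegral_freqWeight_inv_lt_top hs, setLIntegral_norm_inv_sq_lt_top⟩

end Integrals

section Energy

/-- The weighted Sobolev energy of `f`, written on the Fourier side. -/
def energy (ω : ℕ → ℝ) (σ : ℝ) (f : E3 → ℂ) : ℝ≥0∞ :=
  ∫⁻ ξ, freqWeight ω σ ξ ^ 2 * ‖𝓕 f ξ‖ₑ ^ 2

/-- The weighted Sobolev energy of `∇f`, up to constants. -/
def gradEnergy (ω : ℕ → ℝ) (σ : ℝ) (f : E3 → ℂ) : ℝ≥0∞ :=
  ∫⁻ ξ, (‖ξ‖ₑ * freqWeight ω σ ξ) ^ 2 * ‖𝓕 f ξ‖ₑ ^ 2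

lemma measurable_enorm_fourier (f : 𝓢(E3, ℂ)) : Measurable fun ξ => ‖𝓕 (f : E3 → ℂ) ξ‖ₑ :=
  (𝓕 f).continuous.measurable.enorm

lemma HLPw_sq (P : LPCutoff) (ω : ℕ → ℝ) (σ : ℝ) (f : 𝓢(E3, ℂ)) :
    HLPw P ω σ f ^ 2 = ∫⁻ ξ, lpSquareWeight P ω σ ξ * ‖𝓕 (f : E3 → ℂ) ξ‖ₑ ^ 2 := by
  have hf := measurable_enorm_fourier f
  have hm (n : ℕ) : Measurable fun ξ => ENNReal.ofReal (lpSymbol P n ξ ^ 2) := by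
    have := (contDiff_lpSymbol P n).continuous.measurable
    fun_prop
  have hblock (n : ℕ) : eLpNorm (LPblock P n f) 2 volume ^ 2 =
      ∫⁻ ξ, ENNReal.ofReal (lpSymbol P n ξ ^ 2) * ‖𝓕 (f : E3 → ℂ) ξ‖ₑ ^ 2 := by
    have hg : (fun ξ => (lpSymbol P n ξ : ℂ)).HasTemperateGrowth :=
      ((hasCompactSupport_lpSymbol P n).comp_left Complex.ofReal_zero).hasTemperateGrowth
        (Complex.ofRealCLM.contDiff.comp (contDiff_lpSymbol P n))
    have h := eLpNorm_fourierInv_sq (smulLeftCLM ℂ (fun ξ => (lpSymbol P n ξ : ℂ)) (𝓕 f))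
    rw [smulLeftCLM_apply hg] at h
    rw [LPblock_eq]
    simp only [smul_eq_mul, fourier_coe] at h
    rw [h]
    refine lintegral_congr fun ξ => ?_
    rw [enorm_mul, mul_pow, ← ofReal_norm, ← ENNReal.ofReal_pow (norm_nonneg _)]
    simp
  rw [HLPw, ← ENNReal.rpow_natCast, ← ENNReal.rpow_mul]
  norm_num
  simp only [lpSquareWeight, ← ENNReal.tsum_mul_right]
  rw [lintegral_tsum fun n => by have := hm n; fun_prop]
  refine tsum_congr fun n => ?_
  simp only [hblock, mul_assoc]
  rw [lintegral_const_mul _ (by have := hm n; fun_prop)]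

lemma exists_HLPw_sq_equiv (P : LPCutoff) {δ σ : ℝ} (hδ : 0 < δ) (hσ : 0 ≤ σ) :
    ∃ K : ℝ≥0, ∀ ω : ℕ → ℝ, AFweight δ ω → ∀ f : 𝓢(E3, ℂ),
      HLPw P ω σ f ^ 2 ≤ K * energy ω σ f ∧ energy ω σ f ≤ K * HLPw P ω σ f ^ 2 := by
  obtain ⟨K, hK⟩ := exists_lpSquareWeight_equiv P hδ hσ
  refine ⟨K, fun ω h f => ?_⟩
  have hf := measurable_enorm_fourier f
  have h1 := measurable_freqWeight ω σ
  have h2 := measurable_lpSquareWeight P ω σ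
  rw [HLPw_sq, energy, ← lintegral_const_mul _ (by fun_prop), ← lintegral_const_mul _ (by fun_prop)]
  constructor <;> refine lintegral_mono fun ξ => ?_
  · rw [← mul_assoc]
    gcongr
    exact (hK ω h ξ).1
  · rw [← mul_assoc]
    gcongr
    exact (hK ω h ξ).2

lemma energy_sub_le (ω : ℕ → ℝ) (σ : ℝ) (f g : 𝓢(E3, ℂ)) :
    energy ω σ (f - g : 𝓢(E3, ℂ)) ≤ 2 * (energy ω σ f + energy ω σ g) := by
  have hf := measurable_enorm_fourier f
  have hg := measurable_enorm_fourier g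
  have h1 := measurable_freqWeight ω σ
  simp only [energy]
  rw [← lintegral_add_left (by fun_prop), ← lintegral_const_mul _ (by fun_prop)]
  refine lintegral_mono fun ξ => ?_
  have hsub : 𝓕 (f - g) = 𝓕 f - 𝓕 g := (FourierTransform.fourierCLM ℂ 𝓢(E3, ℂ)).map_sub f g
  simp only [← fourier_coe, hsub, sub_apply]
  calc freqWeight ω σ ξ ^ 2 * ‖𝓕 f ξ - 𝓕 g ξ‖ₑ ^ 2
      ≤ freqWeight ω σ ξ ^ 2 * (2 * (‖𝓕 f ξ‖ₑ ^ 2 + ‖𝓕 g ξ‖ₑ ^ 2)) := by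
        gcongr
        exact (pow_le_pow_left' (enorm_sub_le) 2).trans (ENNReal.add_sq_le _ _)
    _ = _ := by ring

lemma gradEnergy_le (ω : ℕ → ℝ) (σ : ℝ) (f : 𝓢(E3, ℝ)) :
    gradEnergy ω σ (complexify f) ≤
      ∑ j : Fin 3, energy ω σ (LineDeriv.lineDerivOp (EuclideanSpace.single j (1 : ℝ))
        (complexify f) : 𝓢(E3, ℂ)) := by
  have h1 := measurable_freqWeight ω σ
  have hf := measurable_enorm_fourier (complexify f)
  simp only [energy, gradEnergy, enorm_fourier_lineDerivOp]
  rw [← lintegral_finsetSum _ fun j _ => by fun_prop]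
  refine lintegral_mono fun ξ => ?_
  simp only [mul_pow, mul_left_comm (freqWeight ω σ ξ ^ 2), ← Finset.sum_mul, mul_assoc]
  gcongr
  rw [← ofReal_norm, ← ENNReal.ofReal_pow (norm_nonneg _), EuclideanSpace.norm_sq_eq,
    ENNReal.ofReal_sum_of_nonneg fun _ _ => by positivity]
  refine Finset.sum_le_sum fun j _ => ?_
  rw [ENNReal.ofReal_pow (norm_nonneg _), Real.norm_eq_abs, ← mul_assoc]
  gcongr
  exact le_mul_of_one_le_left (abs_nonneg _) (by linarith [pi_gt_three])

end Energy

section Product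

variable {δ : ℝ}

lemma energy_mul_le {ω : ℕ → ℝ} (h : AFweight δ ω) {σ : ℝ} (hσ : 0 ≤ σ) (f g : 𝓢(E3, ℂ)) :
    energy ω σ (fun x => f x * g x) ≤ 2 * ENNReal.ofReal (2 ^ (δ + σ)) ^ 2 *
      ((∫⁻ ξ, ‖𝓕 (f : E3 → ℂ) ξ‖ₑ) ^ 2 * energy ω σ g +
        gradEnergy ω (σ - 1) f * (∫⁻ ξ, ‖𝓕 (g : E3 → ℂ) ξ‖ₑ) ^ 2) := by
  set C := ENNReal.ofReal (2 ^ (δ + σ))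
  have hf := measurable_enorm_fourier f
  have hg := measurable_enorm_fourier g
  set a : E3 → ℝ≥0∞ := fun ξ => ‖𝓕 (f : E3 → ℂ) ξ‖ₑ
  set b : E3 → ℝ≥0∞ := fun ξ => ‖𝓕 (g : E3 → ℂ) ξ‖ₑ
  have hw := measurable_freqWeight ω σ
  have hw' := measurable_freqWeight ω (σ - 1)
  set a' : E3 → ℝ≥0∞ := fun ξ => ‖ξ‖ₑ * freqWeight ω (σ - 1) ξ * a ξ
  set b' : E3 → ℝ≥0∞ := fun ξ => freqWeight ω σ ξ * b ξ
  have ha' : Measurable a' := by fun_prop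
  have hb' : Measurable b' := by fun_prop
  have hconv {p q : E3 → ℝ≥0∞} (hp : Measurable p) (hq : Measurable q) :
      Measurable fun ξ => ∫⁻ η, p η * q (ξ - η) :=
    Measurable.lintegral_prod_right' (f := fun z : E3 × E3 => p z.2 * q (z.1 - z.2))
      (by fun_prop)
  have hpt (ξ : E3) : freqWeight ω σ ξ * ‖𝓕 (fun x => f x * g x) ξ‖ₑ ≤
      C * ((∫⁻ η, a η * b' (ξ - η)) + ∫⁻ η, a' η * b (ξ - η)) := by
    calc freqWeight ω σ ξ * ‖𝓕 (fun x => f x * g x) ξ‖ₑ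
        ≤ freqWeight ω σ ξ * ∫⁻ η, a η * b (ξ - η) := by
          gcongr
          exact enorm_fourier_mul_le f g ξ
      _ = ∫⁻ η, freqWeight ω σ ξ * (a η * b (ξ - η)) := by
          rw [lintegral_const_mul _ (by fun_prop)]
      _ ≤ ∫⁻ η, C * (a η * b' (ξ - η) + a' η * b (ξ - η)) := by
          refine lintegral_mono fun η => ?_
          calc _ ≤ C * (freqWeight ω σ (ξ - η) + ‖η‖ₑ * freqWeight ω (σ - 1) η) *
                (a η * b (ξ - η)) := by
                gcongr
                exact freqWeight_le_add h hσ ξ η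
            _ = _ := by
                simp only [a', b']
                ring
      _ = _ := by
          rw [lintegral_const_mul _ (by fun_prop), lintegral_add_left (by fun_prop)]
  calc energy ω σ (fun x => f x * g x)
      ≤ ∫⁻ ξ, 2 * C ^ 2 *
          ((∫⁻ η, a η * b' (ξ - η)) ^ 2 + (∫⁻ η, a' η * b (ξ - η)) ^ 2) := by
        refine lintegral_mono fun ξ => ?_
        rw [← mul_pow]
        refine (pow_le_pow_left' (hpt ξ) 2).trans ?_
        rw [mul_pow, mul_comm 2, mul_assoc]
        gcongr
        exact ENNReal.add_sq_le _ _
    _ = 2 * C ^ 2 * ((∫⁻ ξ, (∫⁻ η, a η * b' (ξ - η)) ^ 2) +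
          ∫⁻ ξ, (∫⁻ η, a' η * b (ξ - η)) ^ 2) := by
        have h1 := (hconv hf hb').pow_const 2
        have h2 := (hconv ha' hg).pow_const 2
        rw [lintegral_const_mul _ (by fun_prop), lintegral_add_left h1]
    _ ≤ 2 * C ^ 2 * ((∫⁻ ξ, a ξ) ^ 2 * (∫⁻ ξ, b' ξ ^ 2) +
          (∫⁻ ξ, a' ξ ^ 2) * (∫⁻ ξ, b ξ) ^ 2) := by
        gcongr
        · exact lintegral_conv_sq_le hf hb'
        · exact lintegral_conv_sq_le' ha' hg
    _ = _ := by
        simp only [a', b', mul_pow, energy, gradEnergy, b, a]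

lemma exists_energy_mul_le {s : ℝ} (hs : 3 / 2 < s) :
    ∃ K : ℝ≥0, ∀ ω : ℕ → ℝ, AFweight δ ω → ∀ f g : 𝓢(E3, ℂ),
      energy ω s (fun x => f x * g x) ≤
        K * (gradEnergy (fun _ => 1) (s - 1) f * energy ω s g +
          gradEnergy ω (s - 1) f * energy (fun _ => 1) s g) := by
  set I := ∫⁻ ξ : E3, ((‖ξ‖ₑ * freqWeight (fun _ => 1) (s - 1) ξ) ^ 2)⁻¹
  set J := ∫⁻ ξ : E3, (freqWeight (fun _ => 1) s ξ ^ 2)⁻¹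
  set C := 2 * ENNReal.ofReal (2 ^ (δ + s)) ^ 2
  have hK : C * (I + J) ≠ ⊤ := by
    have := lintegral_gradWeight_inv_lt_top hs
    have := lintegral_freqWeight_inv_lt_top hs
    finiteness
  refine ⟨(C * (I + J)).toNNReal, fun ω h f g => ?_⟩
  rw [ENNReal.coe_toNNReal hK]
  have hm := measurable_freqWeight (fun _ => 1) s
  have hm' := measurable_freqWeight (fun _ => 1) (s - 1)
  have hf : (∫⁻ ξ, ‖𝓕 (f : E3 → ℂ) ξ‖ₑ) ^ 2 ≤ I * gradEnergy (fun _ => 1) (s - 1) f := by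
    refine lintegral_sq_le_of_weight (by fun_prop) (measurable_enorm_fourier f) ?_
      fun ξ => ENNReal.mul_ne_top enorm_ne_top (freqWeight_ne_top _ _ _)
    filter_upwards [Measure.ae_ne volume (0 : E3)] with ξ hξ
    exact mul_ne_zero (enorm_ne_zero.2 hξ) (freqWeight_one_ne_zero _ _)
  have hg : (∫⁻ ξ, ‖𝓕 (g : E3 → ℂ) ξ‖ₑ) ^ 2 ≤ J * energy (fun _ => 1) s g :=
    lintegral_sq_le_of_weight hm (measurable_enorm_fourier g)
      (.of_forall (freqWeight_one_ne_zero s)) (freqWeight_ne_top _ _)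
  refine (energy_mul_le h (by linarith) f g).trans ?_
  calc _ ≤ C * (((I + J) * gradEnergy (fun _ => 1) (s - 1) f) * energy ω s g +
        gradEnergy ω (s - 1) f * ((I + J) * energy (fun _ => 1) s g)) := by
        gcongr C * (?_ * _ + _ * ?_)
        · exact hf.trans (by gcongr; exact le_self_add)
        · exact hg.trans (by gcongr; exact le_add_self)
    _ = _ := by ring

end Product

section VectorField

lemma ENNReal.rpow_half_sq (t : ℝ≥0∞) : (t ^ ((1 : ℝ) / 2)) ^ 2 = t := by
  rw [← ENNReal.rpow_two, ← ENNReal.rpow_mul]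
  norm_num

lemma HLPwV_sq (P : LPCutoff) (ω : ℕ → ℝ) (σ : ℝ) (u : Fin 3 → E3 → ℝ) :
    HLPwV P ω σ u ^ 2 = ∑ i : Fin 3, HLPw P ω σ (fun x => (u i x : ℂ)) ^ 2 :=
  ENNReal.rpow_half_sq _

lemma gradHLPwV_sq (P : LPCutoff) (ω : ℕ → ℝ) (σ : ℝ) (u : Fin 3 → E3 → ℝ) :
    gradHLPwV P ω σ u ^ 2 =
      ∑ i : Fin 3, ∑ j : Fin 3, HLPw P ω σ (fun x => (pdR j (u i) x : ℂ)) ^ 2 :=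
  ENNReal.rpow_half_sq _

lemma exists_energy_le_HLPwV (P : LPCutoff) {δ σ : ℝ} (hδ : 0 < δ) (hσ : 0 ≤ σ) :
    ∃ K : ℝ≥0, ∀ ω : ℕ → ℝ, AFweight δ ω → ∀ (u : Fin 3 → 𝓢(E3, ℝ)) (i : Fin 3),
      energy ω σ (complexify (u i)) ≤ K * HLPwV P ω σ (toVF u) ^ 2 := by
  obtain ⟨K, hK⟩ := exists_HLPw_sq_equiv P hδ hσ
  refine ⟨K, fun ω h u i => (hK ω h _).2.trans ?_⟩
  rw [HLPwV_sq]
  gcongr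
  exact Finset.single_le_sum (f := fun i => HLPw P ω σ (fun x => (toVF u i x : ℂ)) ^ 2)
    (fun _ _ => zero_le) (Finset.mem_univ i)

lemma exists_gradEnergy_le_gradHLPwV (P : LPCutoff) {δ σ τ : ℝ} (hδ : 0 < δ) (hστ : σ ≤ τ)
    (hτ : 0 ≤ τ) :
    ∃ K : ℝ≥0, ∀ ω : ℕ → ℝ, AFweight δ ω → ∀ (u : Fin 3 → 𝓢(E3, ℝ)) (i : Fin 3),
      gradEnergy ω σ (complexify (u i)) ≤ K * gradHLPwV P ω τ (toVF u) ^ 2 := by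
  obtain ⟨K, hK⟩ := exists_HLPw_sq_equiv P hδ hτ
  refine ⟨K, fun ω h u i => ?_⟩
  calc gradEnergy ω σ (complexify (u i)) ≤ gradEnergy ω τ (complexify (u i)) := by
        refine lintegral_mono fun ξ => ?_
        gcongr
        exact freqWeight_mono h hστ ξ
    _ ≤ ∑ j : Fin 3, K * HLPw P ω τ (fun x => (pdR j (toVF u i) x : ℂ)) ^ 2 := by
        refine (gradEnergy_le ω τ (u i)).trans (Finset.sum_le_sum fun j _ => ?_)
        rw [toVF, pdR_eq]
        exact (hK ω h _).2
    _ ≤ _ := by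
        rw [gradHLPwV_sq, ← Finset.mul_sum]
        refine mul_le_mul' le_rfl ?_
        exact Finset.single_le_sum
          (f := fun i => ∑ j : Fin 3, HLPw P ω τ (fun x => (pdR j (toVF u i) x : ℂ)) ^ 2)
          (fun _ _ => zero_le) (Finset.mem_univ i)

/-- The product of two real Schwartz functions, as a complex-valued Schwartz function. -/
def complexMul (f g : 𝓢(E3, ℝ)) : 𝓢(E3, ℂ) :=
  pairing (ContinuousLinearMap.mul ℂ ℂ) (complexify f) (complexify g)

lemma coe_complexMul (f g : 𝓢(E3, ℝ)) :
    (complexMul f g : E3 → ℂ) = fun x => complexify f x * complexify g x := rfl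

lemma exists_crossVF_eq (u B : Fin 3 → 𝓢(E3, ℝ)) (i : Fin 3) :
    ∃ j k : Fin 3, (fun x => (crossVF (toVF u) (toVF B) i x : ℂ)) =
      (complexMul (u j) (B k) - complexMul (u k) (B j) : 𝓢(E3, ℂ)) := by
  refine ⟨i + 1, i + 2, funext fun x => ?_⟩
  rw [sub_apply, coe_complexMul, coe_complexMul]
  fin_cases i <;> simp [crossVF, toVF, complexify_apply]

end VectorField

/-- Lemma 2.8, the `u × B` estimate in weighted Sobolev spaces:
`∥u × B∥_{H^s(ω)} ≤ C (∥∇u∥_{H^{s'}} ∥B∥_{H^s(ω)} + ∥∇u∥_{H^{s'}(ω)} ∥B∥_{H^s})`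
for `s > 3/2`, `s−1 ≤ s' ≤ s+1`, with `C` independent of the weight `ω ∈ AF(δ)`. -/
theorem cross_estimate_weighted (δ s s' : ℝ) (hδ : 0 < δ) (hs : 3 / 2 < s)
    (hs'1 : s - 1 ≤ s') (hs'2 : s' ≤ s + 1) (P : LPCutoff) :
    ∃ C : ℝ, 0 < C ∧ ∀ ω : ℕ → ℝ, AFweight δ ω → ∀ u B : Fin 3 → SchwartzMap E3 ℝ,
      HLPwV P ω s (crossVF (toVF u) (toVF B)) ≤
        ENNReal.ofReal C *
          (gradHLPV P s' (toVF u) * HLPwV P ω s (toVF B) +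
            gradHLPwV P ω s' (toVF u) * HLPV P s (toVF B)) := by
  obtain ⟨K₁, hK₁⟩ := exists_HLPw_sq_equiv P hδ (show 0 ≤ s by linarith)
  obtain ⟨K₂, hK₂⟩ := exists_energy_mul_le (δ := δ) hs
  obtain ⟨K₃, hK₃⟩ := exists_energy_le_HLPwV P hδ (show 0 ≤ s by linarith)
  obtain ⟨K₄, hK₄⟩ := exists_gradEnergy_le_gradHLPwV P hδ hs'1 (by linarith)
  set K : ℝ≥0 := 12 * (K₁ * (K₂ * (K₄ * K₃)))
  refine ⟨√K + 1, by positivity, fun ω h u B => ?_⟩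
  set X := gradHLPV P s' (toVF u) * HLPwV P ω s (toVF B) +
    gradHLPwV P ω s' (toVF u) * HLPV P s (toVF B) with hX
  have h1 := afweight_one hδ
  have hmul (j k : Fin 3) : energy ω s (complexMul (u j) (B k)) ≤ K₂ * (K₄ * K₃) * X ^ 2 := by
    rw [coe_complexMul]
    calc _ ≤ K₂ * ((K₄ * gradHLPV P s' (toVF u) ^ 2) * (K₃ * HLPwV P ω s (toVF B) ^ 2) +
          (K₄ * gradHLPwV P ω s' (toVF u) ^ 2) * (K₃ * HLPV P s (toVF B) ^ 2)) := by
          refine (hK₂ ω h _ _).trans ?_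
          gcongr
          exacts [hK₄ _ h1 u j, hK₃ ω h B k, hK₄ ω h u j, hK₃ _ h1 B k]
      _ = K₂ * (K₄ * K₃) * ((gradHLPV P s' (toVF u) * HLPwV P ω s (toVF B)) ^ 2 +
          (gradHLPwV P ω s' (toVF u) * HLPV P s (toVF B)) ^ 2) := by ring
      _ ≤ _ := by
          gcongr
          rw [hX, add_sq]
          gcongr
          exact le_self_add
  have hsq : HLPwV P ω s (crossVF (toVF u) (toVF B)) ^ 2 ≤ K * X ^ 2 := by
    rw [HLPwV_sq]
    calc _ ≤ ∑ _i : Fin 3, K₁ * (2 * (K₂ * (K₄ * K₃) * X ^ 2 + K₂ * (K₄ * K₃) * X ^ 2)) := by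
          refine Finset.sum_le_sum fun i _ => ?_
          obtain ⟨j, k, hjk⟩ := exists_crossVF_eq u B i
          rw [hjk]
          refine (hK₁ ω h _).1.trans ?_
          gcongr
          refine (energy_sub_le ω s _ _).trans ?_
          gcongr
          exacts [hmul j k, hmul k j]
      _ = _ := by
          simp only [Finset.sum_const, Finset.card_univ, Fintype.card_fin, nsmul_eq_mul, K]
          push_cast
          ring
  have hroot : (K : ℝ≥0∞) ≤ ENNReal.ofReal (√K + 1) ^ 2 := by
    rw [← ENNReal.ofReal_pow (by positivity), ← ENNReal.ofReal_coe_nnreal]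
    refine ENNReal.ofReal_le_ofReal ?_
    nlinarith [Real.sq_sqrt K.coe_nonneg, Real.sqrt_nonneg K]
  refine (ENNReal.pow_le_pow_left_iff two_ne_zero).1 ?_
  rw [mul_pow]
  exact hsq.trans (by gcongr)

end
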